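/- arXiv:1908.07814 — 2 statements merged into one kernel-verified Lean document; each statement's English description precedes it below -/
import Mathlib

section
/- Let ψ : X → Y be a function between two finite metric spaces such that ψ(X) is D-dense in Y for some D ≥ 0, and let B ⊆ Y be nonempty. Assume moreover that |B| ≤ |Y|/2 and that 1 − N_Y(D)·|∂_D(B)|/|B| ≥ 1/2. Then at least one of the sets A = ψ⁻¹(B) or A = ψ⁻¹(Y ∖ B) satisfies both |A| ≤ |X|/2 and |A| ≥ |B|/(2·N_Y(D)). -/
noncomputable section

namespace QLF

variable {X Y : Type*}

/-- `N_Y(D) = sup_{y ∈ Y} |B(y,D)|`: the maximal cardinality of a closed `D`-ball in the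
finite metric space `Y`. -/
def ballCardSup (Y : Type*) [MetricSpace Y] [Fintype Y] (D : ℝ) : ℕ :=
  letI := Classical.propDecidable
  Finset.univ.sup fun y : Y => (Finset.univ.filter fun z : Y => dist z y ≤ D).card

/-- The outer `S`-boundary `∂_S A = {x ∉ A : d(x,A) ≤ S}` of a subset of a finite metric
space. -/
def outB [MetricSpace Y] [Fintype Y] (A : Finset Y) (S : ℝ) : Finset Y :=
  letI := Classical.propDecidable
  Finset.univ.filter fun x => x ∉ A ∧ ∃ a ∈ A, dist x a ≤ S

/-- The inner `D`-boundary `∂ᶦⁿ_D B = {y ∈ B : d(y, Y∖B) ≤ D}` of a subset of a finite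
metric space. -/
def innB [MetricSpace Y] [Fintype Y] (B : Finset Y) (D : ℝ) : Finset Y :=
  letI := Classical.propDecidable
  B.filter fun y => ∃ z : Y, z ∉ B ∧ dist y z ≤ D

/-- The preimage `ψ⁻¹(B)` as a finset. -/
def preim [Fintype X] (ψ : X → Y) (B : Finset Y) : Finset X :=
  letI := Classical.propDecidable
  Finset.univ.filter fun x => ψ x ∈ B

end QLF

namespace QLF

theorem card_ball_le_ballCardSup {Y : Type*} [MetricSpace Y] [Fintype Y]
    (D : ℝ) (y : Y) (s : Finset Y) (hs : ∀ z ∈ s, dist z y ≤ D) :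
    s.card ≤ ballCardSup Y D := by
  classical
  unfold ballCardSup
  refine le_trans (Finset.card_le_card fun z hz => ?_)
    (Finset.le_sup (f := fun y : Y => (Finset.univ.filter fun z : Y => dist z y ≤ D).card)
      (Finset.mem_univ y)) |>.trans (le_of_eq ?_)
  · simpa using hs z hz
  · congr!

/-- A set covered by the `D`-balls around `u` has at most `N_Y(D) * |u|` elements. -/
theorem card_le_card_mul_ballCardSup {Y : Type*} [MetricSpace Y] [Fintype Y]
    (D : ℝ) (s u : Finset Y) (h : ∀ y ∈ s, ∃ z ∈ u, dist y z ≤ D) :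
    s.card ≤ u.card * ballCardSup Y D := by
  classical
  calc s.card ≤ (u.biUnion fun z => Finset.univ.filter fun y => dist y z ≤ D).card :=
        Finset.card_le_card fun y hy => by simpa using h y hy
    _ ≤ u.card * ballCardSup Y D := Finset.card_biUnion_le_card_mul _ _ _ fun z _ =>
        card_ball_le_ballCardSup D z _ (by simp)

theorem mem_preim {X Y : Type*} [Fintype X] {ψ : X → Y} {B : Finset Y} {x : X} :
    x ∈ preim ψ B ↔ ψ x ∈ B := by
  simp [preim]

theorem mem_outB {Y : Type*} [MetricSpace Y] [Fintype Y] {B : Finset Y} {D : ℝ} {y : Y} :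
    y ∈ outB B D ↔ y ∉ B ∧ ∃ b ∈ B, dist y b ≤ D := by
  simp [outB]

theorem card_preim_add_card_preim_compl {X Y : Type*} [Fintype X] [Fintype Y] [DecidableEq Y]
    (ψ : X → Y) (B : Finset Y) :
    (preim ψ B).card + (preim ψ (Finset.univ \ B)).card = Fintype.card X := by
  classical
  rw [← Finset.card_add_card_compl (preim ψ B)]
  congr 2
  ext x
  simp [mem_preim]

/-- If every point of `s` is `D`-close to `ψ(ψ⁻¹(t))` or to `∂_D B`, then
`|s| ≤ N_Y(D) * (|ψ⁻¹(t)| + |∂_D B|)`. -/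
theorem card_le_preim_add_outB {X Y : Type*} [MetricSpace Y] [Fintype X] [Fintype Y]
    (ψ : X → Y) (D : ℝ) (B s t : Finset Y)
    (h : ∀ y ∈ s, (∃ x, ψ x ∈ t ∧ dist y (ψ x) ≤ D) ∨ ∃ z ∈ outB B D, dist y z ≤ D) :
    s.card ≤ ((preim ψ t).card + (outB B D).card) * ballCardSup Y D := by
  classical
  refine (card_le_card_mul_ballCardSup D s ((preim ψ t).image ψ ∪ outB B D) fun y hy => ?_).trans
    (Nat.mul_le_mul_right _ ((Finset.card_union_le _ _).trans
      (Nat.add_le_add_right Finset.card_image_le _)))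
  rcases h y hy with ⟨x, hx, hxy⟩ | ⟨z, hz, hyz⟩
  · exact ⟨ψ x, Finset.mem_union_left _ (Finset.mem_image_of_mem ψ (mem_preim.2 hx)), hxy⟩
  · exact ⟨z, Finset.mem_union_right _ hz, hyz⟩

end QLF

open QLF in
/-- **Lemma 3.12.** Under the assumptions of Lemma 3.11, if moreover
`|B| ≤ |Y|/2` and `1 − N_Y(D)·|∂_D(B)|/|B| ≥ 1/2`, then `A = ψ⁻¹(B)` or `A = ψ⁻¹(Y∖B)`
satisfies `|A| ≤ |X|/2` and `|A| ≥ |B|/(2 N_Y(D))`. -/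
theorem preimage_or_preimage_compl {X Y : Type*} [MetricSpace X] [MetricSpace Y]
    [Fintype X] [Fintype Y] [DecidableEq Y] (ψ : X → Y) (D : ℝ) (hD : 0 ≤ D)
    (hdense : ∀ y : Y, ∃ x : X, dist (ψ x) y ≤ D)
    (B : Finset Y) (hB : B.Nonempty)
    (hhalf : (B.card : ℝ) ≤ (Fintype.card Y : ℝ) / 2)
    (hbd : (1 : ℝ) - (ballCardSup Y D : ℝ) * ((outB B D).card : ℝ) / (B.card : ℝ) ≥ 1 / 2) :
    (((preim ψ B).card : ℝ) ≤ (Fintype.card X : ℝ) / 2 ∧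
      (B.card : ℝ) / (2 * (ballCardSup Y D : ℝ)) ≤ ((preim ψ B).card : ℝ)) ∨
    (((preim ψ (Finset.univ \ B)).card : ℝ) ≤ (Fintype.card X : ℝ) / 2 ∧
      (B.card : ℝ) / (2 * (ballCardSup Y D : ℝ)) ≤ ((preim ψ (Finset.univ \ B)).card : ℝ)) := by
  have hBpos : (0 : ℝ) < B.card := by exact_mod_cast hB.card_pos
  have hN : (0 : ℝ) < ballCardSup Y D := by
    obtain ⟨b, -⟩ := hB
    exact_mod_cast card_ball_le_ballCardSup D b {b} (by simpa using hD)
  have hout : (ballCardSup Y D : ℝ) * (outB B D).card ≤ B.card / 2 := by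
    have : (ballCardSup Y D : ℝ) * (outB B D).card / B.card ≤ 1 / 2 := by linarith
    rw [div_le_iff₀ hBpos] at this
    linarith
  have hcover : (B.card : ℝ) ≤
      ((preim ψ B).card + (outB B D).card) * ballCardSup Y D := by
    refine mod_cast card_le_preim_add_outB ψ D B B B fun y hy => ?_
    obtain ⟨x, hx⟩ := hdense y
    by_cases hxB : ψ x ∈ B
    · exact .inl ⟨x, hxB, by rwa [dist_comm]⟩
    · exact .inr ⟨ψ x, mem_outB.2 ⟨hxB, y, hy, hx⟩, by rwa [dist_comm]⟩
  have hcover_compl : ((Finset.univ \ B).card : ℝ) ≤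
      ((preim ψ (Finset.univ \ B)).card + (outB B D).card) * ballCardSup Y D := by
    refine mod_cast card_le_preim_add_outB ψ D B _ (Finset.univ \ B) fun y hy => ?_
    obtain ⟨x, hx⟩ := hdense y
    rw [dist_comm] at hx
    by_cases hxB : ψ x ∈ B
    · exact .inr ⟨y, mem_outB.2 ⟨by simpa using hy, ψ x, hxB, hx⟩, by simpa using hD⟩
    · exact .inl ⟨x, by simpa using hxB, hx⟩
  have hcompl : ((Finset.univ \ B).card : ℝ) + B.card = Fintype.card Y := by
    exact_mod_cast Finset.card_sdiff_add_card_eq_card (Finset.subset_univ B)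
  have hsum : ((preim ψ B).card : ℝ) + (preim ψ (Finset.univ \ B)).card = Fintype.card X := by
    exact_mod_cast card_preim_add_card_preim_compl ψ B
  rw [div_le_iff₀ (by positivity), div_le_iff₀ (by positivity)]
  rcases le_total ((preim ψ B).card : ℝ) (Fintype.card X / 2) with h | h
  · exact .inl ⟨h, by linarith⟩
  · exact .inr ⟨by linarith, by linarith⟩
end
end

section
/- Let {X_n} and {Y_n} be sequences of finite nonempty metric spaces with |X_n| → ∞ and |Y_n| → ∞ as n → ∞, such that some coarse disjoint unions X = ⊔_n X_n and Y = ⊔_n Y_n have bounded geometry. Assume there exists D ≥ 0 such that every X_n and every Y_n is D-connected. If X and Y are coarsely equivalent and {X_n} is a sequence of asymptotic expanders, then {Y_n} is also a sequence of asymptotic expanders. -/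
noncomputable section

namespace QL

variable {X : Type*}

/-- `X` has bounded geometry: closed balls of each fixed radius have uniformly bounded
(finite) cardinality. -/
def BoundedGeometry (X : Type*) [MetricSpace X] : Prop :=
  ∀ R : ℝ, 0 < R → ∃ C : ℕ, ∀ x : X,
    (Metric.closedBall x R).Finite ∧ (Metric.closedBall x R).ncard ≤ C

/-- `X` is a coarse disjoint union of the sequence of pieces `Xn`: the pieces partition `X`,
are nonempty, and `d(Xn, Xm) → ∞` as `n + m → ∞` with `n ≠ m` (each piece carries the
restriction of the metric of `X`). -/
def IsCoarseDisjointUnion [MetricSpace X] (Xn : ℕ → Finset X) : Prop :=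
  (∀ x : X, ∃! n : ℕ, x ∈ Xn n) ∧
  (∀ n : ℕ, (Xn n).Nonempty) ∧
  (∀ K : ℝ, ∃ N : ℕ, ∀ m n : ℕ, m ≠ n → N ≤ m + n →
    ∀ x ∈ Xn m, ∀ y ∈ Xn n, K ≤ dist x y)

/-- The outer `R`-boundary of `A` taken inside the subspace `Xn`:
`{x ∈ Xn \ A : d(x, A) ≤ R}`. -/
def outBdry [MetricSpace X] (Xn A : Finset X) (R : ℝ) : Finset X :=
  letI := Classical.propDecidable
  Xn.filter fun x => x ∉ A ∧ ∃ a ∈ A, dist x a ≤ R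

/-- A sequence of pieces `Xn` (each carrying the restriction of the ambient metric) is a
sequence of asymptotic expanders: for every `α > 0` there are `c ∈ (0,1)` and `R > 0` such
that every `A ⊆ Xn` with `α|Xn| ≤ |A| ≤ |Xn|/2` satisfies `|∂_R A| > c|A|`,
boundaries being taken inside `Xn`. -/
def IsAsymptoticExpanderSeq [MetricSpace X] (Xn : ℕ → Finset X) : Prop :=
  ∀ α : ℝ, 0 < α → ∃ c ∈ Set.Ioo (0 : ℝ) 1, ∃ R : ℝ, 0 < R ∧
    ∀ n : ℕ, ∀ A : Finset X, A ⊆ Xn n →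
      α * ((Xn n).card : ℝ) ≤ (A.card : ℝ) → (A.card : ℝ) ≤ ((Xn n).card : ℝ) / 2 →
      c * (A.card : ℝ) < ((outBdry (Xn n) A R).card : ℝ)

end QL

namespace QL

open Filter

section Expanders

variable {X : Type*} [MetricSpace X]

theorem mem_outBdry {P A : Finset X} {R : ℝ} {x : X} :
    x ∈ outBdry P A R ↔ x ∈ P ∧ x ∉ A ∧ ∃ a ∈ A, dist x a ≤ R := by
  simp [outBdry]

theorem outBdry_mono (P A : Finset X) {R S : ℝ} (h : R ≤ S) :
    outBdry P A R ⊆ outBdry P A S := by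
  intro x hx
  obtain ⟨hP, hA, a, ha, hd⟩ := mem_outBdry.1 hx
  exact mem_outBdry.2 ⟨hP, hA, a, ha, hd.trans h⟩

/-- The two-sided form of asymptotic expansion: sets occupying, together with their complement,
a definite proportion of the piece have a boundary of definite proportion. -/
theorem IsAsymptoticExpanderSeq.two_sided [DecidableEq X] {Xn : ℕ → Finset X}
    (h : IsAsymptoticExpanderSeq Xn) {α : ℝ} (hα : 0 < α) :
    ∃ c : ℝ, 0 < c ∧ ∃ R : ℝ, ∀ n : ℕ, ∀ A ⊆ Xn n,
      α * ((Xn n).card : ℝ) ≤ A.card → α * ((Xn n).card : ℝ) ≤ (Xn n \ A).card →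
      c * ((Xn n).card : ℝ) ≤ (outBdry (Xn n) A R).card := by
  obtain ⟨c, ⟨hc0, hc1⟩, R, -, H⟩ := h (α / 2) (by positivity)
  refine ⟨c * (α / 2), by positivity, R, fun n A hA h1 h2 => ?_⟩
  have hN : (0 : ℝ) ≤ (Xn n).card := by positivity
  have hαN : 0 ≤ α * ((Xn n).card : ℝ) := by positivity
  have hsum : ((Xn n \ A).card : ℝ) + A.card = (Xn n).card := by
    exact_mod_cast Finset.card_sdiff_add_card_eq_card hA
  rcases le_or_gt (A.card : ℝ) ((Xn n).card / 2) with hle | hgt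
  · have := H n A hA (by linarith) hle
    have := mul_le_mul_of_nonneg_left h1 hc0.le
    nlinarith [mul_nonneg hc0.le hαN]
  · rcases le_or_gt (α / 2 * ((Xn n).card : ℝ)) (outBdry (Xn n) A R).card with hb | hb
    · nlinarith [mul_nonneg (sub_nonneg.2 hc1.le) hαN]
    · set A' := (Xn n \ A) \ outBdry (Xn n) A R with hA'
      have hsub : outBdry (Xn n) A R ⊆ Xn n \ A := fun x hx =>
        Finset.mem_sdiff.2 ⟨(mem_outBdry.1 hx).1, (mem_outBdry.1 hx).2.1⟩
      have hcard : (A'.card : ℝ) + (outBdry (Xn n) A R).card = (Xn n \ A).card := by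
        exact_mod_cast Finset.card_sdiff_add_card_eq_card hsub
      have hb0 : (0 : ℝ) ≤ (outBdry (Xn n) A R).card := by positivity
      have hlow : α / 2 * ((Xn n).card : ℝ) ≤ A'.card := by linarith
      have hexp := H n A' (Finset.sdiff_subset.trans Finset.sdiff_subset) hlow (by linarith)
      have hbd : outBdry (Xn n) A' R ⊆ outBdry (Xn n) A R := by
        intro x hx
        obtain ⟨hxX, hxA', a, ha, hd⟩ := mem_outBdry.1 hx
        obtain ⟨ha1, ha2⟩ := Finset.mem_sdiff.1 ha
        obtain ⟨haX, haA⟩ := Finset.mem_sdiff.1 ha1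
        have hxA : x ∉ A := fun hxA =>
          ha2 (mem_outBdry.2 ⟨haX, haA, x, hxA, by rwa [dist_comm]⟩)
        by_contra hx'
        exact hxA' (Finset.mem_sdiff.2 ⟨Finset.mem_sdiff.2 ⟨hxX, hxA⟩, hx'⟩)
      have hle : ((outBdry (Xn n) A' R).card : ℝ) ≤ (outBdry (Xn n) A R).card := by
        exact_mod_cast Finset.card_le_card hbd
      have := mul_le_mul_of_nonneg_left hlow hc0.le
      linarith

/-- Finitely many pieces are irrelevant for being a sequence of asymptotic expanders. -/
theorem IsAsymptoticExpanderSeq.of_eventually {Xn : ℕ → Finset X}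
    (hne : ∀ n, (Xn n).Nonempty)
    (h : ∀ α : ℝ, 0 < α → ∃ c ∈ Set.Ioo (0 : ℝ) 1, ∃ R : ℝ, ∀ᶠ n in atTop,
      ∀ A : Finset X, A ⊆ Xn n →
      α * ((Xn n).card : ℝ) ≤ (A.card : ℝ) → (A.card : ℝ) ≤ ((Xn n).card : ℝ) / 2 →
      c * (A.card : ℝ) < ((outBdry (Xn n) A R).card : ℝ)) :
    IsAsymptoticExpanderSeq Xn := by
  classical
  intro α hα
  obtain ⟨c, hc, R, hR⟩ := h α hα
  obtain ⟨M, hM⟩ := eventually_atTop.1 hR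
  set F : Finset X := (Finset.range M).biUnion Xn with hF
  set R' : ℝ := max (max R 1) (Metric.diam (F : Set X)) with hR'
  refine ⟨c, hc, R', lt_of_lt_of_le one_pos ((le_max_right _ _).trans (le_max_left _ _)),
    fun n A hA h1 h2 => ?_⟩
  rcases le_or_gt M n with hn | hn
  · refine (hM n hn A hA h1 h2).trans_le ?_
    exact_mod_cast Finset.card_le_card
      (outBdry_mono _ _ ((le_max_left _ _).trans (le_max_left _ _)))
  · have hNpos : (0 : ℝ) < (Xn n).card := by exact_mod_cast (hne n).card_pos
    have hApos : (0 : ℝ) < A.card := (mul_pos hα hNpos).trans_le h1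
    obtain ⟨a, ha⟩ : A.Nonempty := Finset.card_pos.1 (by exact_mod_cast hApos)
    have hXF : ∀ x ∈ Xn n, x ∈ (F : Set X) := fun x hx =>
      Finset.mem_coe.2 (Finset.mem_biUnion.2 ⟨n, Finset.mem_range.2 hn, hx⟩)
    have hsub : Xn n \ A ⊆ outBdry (Xn n) A R' := by
      intro x hx
      obtain ⟨hx1, hx2⟩ := Finset.mem_sdiff.1 hx
      exact mem_outBdry.2 ⟨hx1, hx2, a, ha, (Metric.dist_le_diam_of_mem
        F.finite_toSet.isBounded (hXF x hx1) (hXF a (hA ha))).trans (le_max_right _ _)⟩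
    have hsum : ((Xn n \ A).card : ℝ) + A.card = (Xn n).card := by
      exact_mod_cast Finset.card_sdiff_add_card_eq_card hA
    have hle : ((Xn n \ A).card : ℝ) ≤ (outBdry (Xn n) A R').card := by
      exact_mod_cast Finset.card_le_card hsub
    nlinarith [mul_pos (sub_pos.2 hc.2) hApos]

theorem IsCoarseDisjointUnion.eventually_mem {Xn : ℕ → Finset X}
    (h : IsCoarseDisjointUnion Xn) (K : ℝ) :
    ∀ᶠ n in atTop, ∀ x ∈ Xn n, ∀ y, dist x y ≤ K → y ∈ Xn n := by
  obtain ⟨N, hN⟩ := h.2.2 (K + 1)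
  filter_upwards [eventually_ge_atTop N] with n hn x hx y hxy
  obtain ⟨m, hm, -⟩ := h.1 y
  by_cases hmn : n = m
  · rwa [hmn]
  · have := hN n m hmn (by omega) x hx y hm
    linarith

theorem BoundedGeometry.exists_card_le (h : BoundedGeometry X) (R : ℝ) :
    ∃ C : ℕ, 0 < C ∧ ∀ (x : X) (s : Finset X), (∀ y ∈ s, dist y x ≤ R) → s.card ≤ C := by
  obtain ⟨C, hC⟩ := h (max R 1) (lt_of_lt_of_le one_pos (le_max_right _ _))
  refine ⟨C + 1, C.succ_pos, fun x s hs => ?_⟩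
  have hsub : (s : Set X) ⊆ Metric.closedBall x (max R 1) := fun y hy =>
    Metric.mem_closedBall.2 ((hs y hy).trans (le_max_left _ _))
  have := Set.ncard_le_ncard hsub (hC x).1
  rw [Set.ncard_coe_finset] at this
  exact this.trans ((hC x).2.trans C.le_succ)

end Expanders

section CoarseEquivalence

variable {X Y : Type*} [MetricSpace X] [MetricSpace Y]

theorem exists_dist_le_of_dist_map_le {f : X → Y} {ρ : ℝ → ℝ} (hρ : Tendsto ρ atTop atTop)
    (hf : ∀ x y, ρ (dist x y) ≤ dist (f x) (f y)) (K : ℝ) :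
    ∃ S : ℝ, ∀ x y, dist (f x) (f y) ≤ K → dist x y ≤ S := by
  obtain ⟨S, hS⟩ := eventually_atTop.1 (hρ.eventually_gt_atTop K)
  refine ⟨S, fun x y hxy => ?_⟩
  by_contra! h
  exact absurd (hf x y) (not_le.2 (hxy.trans_lt (hS _ h.le)))

theorem mem_of_chain {P : Finset X} {K : ℝ} (hP : ∀ x ∈ P, ∀ y, dist x y ≤ K → y ∈ P)
    {k : ℕ} {p : ℕ → X} (h0 : p 0 ∈ P) (hp : ∀ i < k, dist (p i) (p (i + 1)) ≤ K) :
    p k ∈ P := by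
  induction k with
  | zero => exact h0
  | succ k ih => exact hP _ (ih fun i hi => hp i (by omega)) _ (hp k k.lt_succ_self)

/-- Points mapped far out by `f` lie far out. -/
theorem eventually_index_ge {X Y : Type*} {Xn : ℕ → Finset X} {Yn : ℕ → Finset Y}
    (hY : ∀ y : Y, ∃! n : ℕ, y ∈ Yn n) (f : X → Y) (N : ℕ) :
    ∀ᶠ m in atTop, ∀ x, f x ∈ Yn m → ∀ n, x ∈ Xn n → N ≤ n := by
  classical
  choose idx hidx huniq using hY
  set F : Finset X := (Finset.range N).biUnion Xn with hF
  filter_upwards [eventually_gt_atTop (F.sup fun x => idx (f x))] with m hm x hx n hn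
  by_contra! hlt
  have hxF : x ∈ F := Finset.mem_biUnion.2 ⟨n, Finset.mem_range.2 hlt, hn⟩
  have h1 : idx (f x) ≤ F.sup fun x => idx (f x) :=
    Finset.le_sup (f := fun x => idx (f x)) hxF
  have h2 := huniq (f x) m hx
  omega

/-- A coarse equivalence between coarse disjoint unions of uniformly coarsely connected pieces
matches all but finitely many pieces of the target with pieces of the source. -/
theorem eventually_exists_preimage_piece {Xn : ℕ → Finset X} {Yn : ℕ → Finset Y}
    (hX : IsCoarseDisjointUnion Xn) (hY : IsCoarseDisjointUnion Yn) {D : ℝ}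
    (hXconn : ∀ n : ℕ, ∀ x ∈ Xn n, ∀ y ∈ Xn n, ∃ (k : ℕ) (p : ℕ → X),
      p 0 = x ∧ p k = y ∧ (∀ i ≤ k, p i ∈ Xn n) ∧ ∀ i < k, dist (p i) (p (i + 1)) ≤ D)
    (hYconn : ∀ n : ℕ, ∀ x ∈ Yn n, ∀ y ∈ Yn n, ∃ (k : ℕ) (p : ℕ → Y),
      p 0 = x ∧ p k = y ∧ (∀ i ≤ k, p i ∈ Yn n) ∧ ∀ i < k, dist (p i) (p (i + 1)) ≤ D)
    {f : X → Y} {g : Y → X} {ρ ρ' : ℝ → ℝ} {δ : ℝ} (hρ' : Monotone ρ')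
    (hρ : Tendsto ρ atTop atTop) (hf : ∀ x y, ρ (dist x y) ≤ dist (f x) (f y))
    (hf' : ∀ x y, dist (f x) (f y) ≤ ρ' (dist x y)) (hg : ∀ y, dist (f (g y)) y ≤ δ) :
    ∀ᶠ m in atTop, ∃ n, ∀ x, x ∈ Xn n ↔ f x ∈ Yn m := by
  obtain ⟨S, hS⟩ := exists_dist_le_of_dist_map_le hρ hf (δ + D + δ)
  obtain ⟨T, hT⟩ := exists_dist_le_of_dist_map_le hρ hf δ
  obtain ⟨N, hN⟩ :=
    eventually_atTop.1 ((hX.eventually_mem S).and (hX.eventually_mem T))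
  filter_upwards [hY.eventually_mem δ, hY.eventually_mem (ρ' D),
    eventually_index_ge (Xn := Xn) hY.1 f N] with m hm1 hm2 hm3
  obtain ⟨y₀, hy₀⟩ := hY.2.1 m
  have hx₀ : f (g y₀) ∈ Yn m := hm1 y₀ hy₀ _ (by rw [dist_comm]; exact hg y₀)
  obtain ⟨n, hn, -⟩ := hX.1 (g y₀)
  obtain ⟨hnS, hnT⟩ := hN n (hm3 _ hx₀ n hn)
  refine ⟨n, fun x => ⟨fun hx => ?_, fun hx => ?_⟩⟩
  · obtain ⟨k, p, h0, hk, -, hp⟩ := hXconn n _ hn x hx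
    rw [← hk]
    refine mem_of_chain (p := fun i => f (p i)) hm2 (by simpa only [h0] using hx₀) fun i hi => ?_
    exact (hf' _ _).trans (hρ' (hp i hi))
  · obtain ⟨k, p, h0, hk, -, hp⟩ := hYconn m _ hy₀ _ hx
    have hgk : g (p k) ∈ Xn n := by
      refine mem_of_chain (p := fun i => g (p i)) hnS (by simpa only [h0] using hn)
        fun i hi => hS _ _ ?_
      calc dist (f (g (p i))) (f (g (p (i + 1))))
          ≤ dist (f (g (p i))) (p i) + dist (p i) (p (i + 1))
            + dist (p (i + 1)) (f (g (p (i + 1)))) := dist_triangle4 _ _ _ _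
        _ ≤ δ + D + δ :=
          add_le_add (add_le_add (hg _) (hp i hi)) (by rw [dist_comm]; exact hg _)
    rw [hk] at hgk
    exact hnT _ hgk x (hT _ _ (hg _))

/-- The transfer of boundary estimates along a map between two finite pieces which is
coarsely surjective and has uniformly bounded fibres. -/
theorem card_outBdry_ge_of_map [DecidableEq X] {P : Finset X} {Q A : Finset Y} {f : X → Y}
    {g : Y → X} {ρ' : ℝ → ℝ} {δ α c R R' : ℝ} {C : ℕ} (hC : 0 < C) (hδ : 0 ≤ δ)
    (hρ' : Monotone ρ') (hf' : ∀ x y, dist (f x) (f y) ≤ ρ' (dist x y))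
    (hfP : ∀ x ∈ P, f x ∈ Q) (hgQ : ∀ y ∈ Q, g y ∈ P) (hg : ∀ y, dist (f (g y)) y ≤ δ)
    (hCf : ∀ (s : Finset X) (y : Y), (∀ x ∈ s, f x = y) → s.card ≤ C)
    (hCg : ∀ (s : Finset Y) (x : X), (∀ y ∈ s, g y = x) → s.card ≤ C)
    (hα : 0 < α) (hα2 : α ≤ 1 / 4) (hc : 0 ≤ c)
    (hexp : ∀ B ⊆ P, α / C ^ 2 * (P.card : ℝ) ≤ B.card →
      α / C ^ 2 * (P.card : ℝ) ≤ (P \ B).card → c * (P.card : ℝ) ≤ (outBdry P B R).card)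
    (hR1 : 2 * δ ≤ R') (hR2 : ρ' R + δ ≤ R')
    (hAQ : A ⊆ Q) (hA1 : α * (Q.card : ℝ) ≤ A.card) (hA2 : (A.card : ℝ) ≤ Q.card / 2) :
    min (1 / 4) (c / C ^ 2) * (Q.card : ℝ) ≤ (outBdry Q A R').card := by
  classical
  have hC' : (0 : ℝ) < C := by exact_mod_cast hC
  have hQ0 : (0 : ℝ) ≤ Q.card := by positivity
  rcases le_or_gt ((Q.card : ℝ) / 4) (outBdry Q A R').card with hb | hb
  · exact (mul_le_mul_of_nonneg_right (min_le_left _ _) hQ0).trans (by linarith)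
  have hmapf : ∀ (s : Finset X) (t : Finset Y), (∀ x ∈ s, f x ∈ t) →
      (s.card : ℝ) ≤ C * t.card := fun s t h => by
    exact_mod_cast Finset.card_le_mul_card_image_of_maps_to h C fun y _ =>
      hCf _ y fun x hx => (Finset.mem_filter.1 hx).2
  have hmapg : ∀ (s : Finset Y) (t : Finset X), (∀ y ∈ s, g y ∈ t) →
      (s.card : ℝ) ≤ C * t.card := fun s t h => by
    exact_mod_cast Finset.card_le_mul_card_image_of_maps_to h C fun x _ =>
      hCg _ x fun y hy => (Finset.mem_filter.1 hy).2
  have hPQ := hmapf P Q hfP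
  have hQP := hmapg Q P hgQ
  set B : Finset X := P.filter fun x => ∃ a ∈ A, dist (f x) a ≤ δ with hB
  have hAB : (A.card : ℝ) ≤ C * B.card := hmapg A B fun y hy =>
    Finset.mem_filter.2 ⟨hgQ y (hAQ hy), y, hy, hg y⟩
  have hsum : ((Q \ A).card : ℝ) + A.card = Q.card := by
    exact_mod_cast Finset.card_sdiff_add_card_eq_card hAQ
  have hsub : outBdry Q A R' ⊆ Q \ A := fun x hx =>
    Finset.mem_sdiff.2 ⟨(mem_outBdry.1 hx).1, (mem_outBdry.1 hx).2.1⟩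
  have hsum' : (((Q \ A) \ outBdry Q A R').card : ℝ) + (outBdry Q A R').card
      = (Q \ A).card := by
    exact_mod_cast Finset.card_sdiff_add_card_eq_card hsub
  have hcompl : (((Q \ A) \ outBdry Q A R').card : ℝ) ≤ C * (P \ B).card := by
    refine hmapg _ _ fun y hy => ?_
    obtain ⟨hy1, hy2⟩ := Finset.mem_sdiff.1 hy
    obtain ⟨hyQ, hyA⟩ := Finset.mem_sdiff.1 hy1
    refine Finset.mem_sdiff.2 ⟨hgQ y hyQ, fun hyB => ?_⟩
    obtain ⟨-, a, ha, hd⟩ := Finset.mem_filter.1 hyB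
    refine hy2 (mem_outBdry.2 ⟨hyQ, hyA, a, ha, ?_⟩)
    have h1 := dist_triangle y (f (g y)) a
    have h2 := hg y
    rw [dist_comm] at h2
    linarith
  have hscale : ∀ t : ℝ, α * Q.card ≤ C * t → α / C ^ 2 * (P.card : ℝ) ≤ t := fun t ht => by
    rw [div_mul_eq_mul_div, div_le_iff₀ (by positivity)]
    have h1 := mul_le_mul_of_nonneg_left hPQ hα.le
    have h2 := mul_le_mul_of_nonneg_left ht hC'.le
    linarith
  have hαQ : α * (Q.card : ℝ) ≤ 1 / 4 * Q.card := mul_le_mul_of_nonneg_right hα2 hQ0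
  have hbdB := hexp B (Finset.filter_subset _ _) (hscale _ (by linarith))
    (hscale _ (by linarith))
  have hbd : ((outBdry P B R).card : ℝ) ≤ C * (outBdry Q A R').card := by
    refine hmapf _ _ fun x hx => ?_
    obtain ⟨hxP, hxB, b, hb, hd⟩ := mem_outBdry.1 hx
    obtain ⟨-, a, ha, hda⟩ := Finset.mem_filter.1 hb
    refine mem_outBdry.2 ⟨hfP x hxP, fun hxA => hxB (Finset.mem_filter.2
      ⟨hxP, f x, hxA, by simpa using hδ⟩), a, ha, ?_⟩
    have h1 := dist_triangle (f x) (f b) a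
    have h2 := (hf' x b).trans (hρ' hd)
    linarith
  refine (mul_le_mul_of_nonneg_right (min_le_right _ _) hQ0).trans ?_
  rw [div_mul_eq_mul_div, div_le_iff₀ (by positivity)]
  have h1 := mul_le_mul_of_nonneg_left hQP hc
  have h2 := mul_le_mul_of_nonneg_left (hbdB.trans hbd) hC'.le
  linarith

end CoarseEquivalence

end QL

open QL Filter in
/-- **Theorem C / Corollary 3.9.** Let `X` and `Y` be bounded geometry coarse
disjoint unions of sequences of finite nonempty metric spaces `Xn`, `Yn` with
`|Xn|, |Yn| → ∞`, and suppose each piece `Xn`, `Yn` is `D`-connected for a common `D ≥ 0`.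
If `X` and `Y` are coarsely equivalent and `{Xn}` is a sequence of asymptotic expanders,
then so is `{Yn}`. -/
theorem asymptoticExpander_coarse_invariance {X Y : Type*}
    [MetricSpace X] [MetricSpace Y]
    (Xn : ℕ → Finset X) (Yn : ℕ → Finset Y)
    (hXcdu : IsCoarseDisjointUnion Xn) (hYcdu : IsCoarseDisjointUnion Yn)
    (hXgrow : Tendsto (fun n => (Xn n).card) atTop atTop)
    (hYgrow : Tendsto (fun n => (Yn n).card) atTop atTop)
    (hXbg : BoundedGeometry X) (hYbg : BoundedGeometry Y)
    (D : ℝ) (hD : 0 ≤ D)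
    (hXconn : ∀ n : ℕ, ∀ x ∈ Xn n, ∀ y ∈ Xn n, ∃ (k : ℕ) (p : ℕ → X),
      p 0 = x ∧ p k = y ∧ (∀ i ≤ k, p i ∈ Xn n) ∧ ∀ i < k, dist (p i) (p (i + 1)) ≤ D)
    (hYconn : ∀ n : ℕ, ∀ x ∈ Yn n, ∀ y ∈ Yn n, ∃ (k : ℕ) (p : ℕ → Y),
      p 0 = x ∧ p k = y ∧ (∀ i ≤ k, p i ∈ Yn n) ∧ ∀ i < k, dist (p i) (p (i + 1)) ≤ D)
    (hce : ∃ (f : X → Y) (ρminus ρplus : ℝ → ℝ) (D' : ℝ), 0 ≤ D' ∧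
      Monotone ρminus ∧ Monotone ρplus ∧ Tendsto ρminus atTop atTop ∧
      (∀ x y : X, ρminus (dist x y) ≤ dist (f x) (f y) ∧
        dist (f x) (f y) ≤ ρplus (dist x y)) ∧
      (∀ y : Y, ∃ x : X, dist (f x) y ≤ D'))
    (hexp : IsAsymptoticExpanderSeq Xn) :
    IsAsymptoticExpanderSeq Yn := by
  classical
  obtain ⟨f, ρ, ρ', δ, hδ, -, hρ', hρ, hf, hsurj⟩ := hce
  choose g hg using hsurj
  obtain ⟨T, hT⟩ := exists_dist_le_of_dist_map_le hρ (fun x y => (hf x y).1) 0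
  obtain ⟨C₁, hC₁, hCX⟩ := hXbg.exists_card_le T
  obtain ⟨C₂, -, hCY⟩ := hYbg.exists_card_le δ
  have hC : 0 < max C₁ C₂ := lt_max_of_lt_left hC₁
  have hC' : (0 : ℝ) < (max C₁ C₂ : ℕ) := by exact_mod_cast hC
  have hCf : ∀ (s : Finset X) (y : Y), (∀ x ∈ s, f x = y) → s.card ≤ max C₁ C₂ := by
    intro s y hs
    rcases s.eq_empty_or_nonempty with rfl | ⟨x, hx⟩
    · simp
    · exact (hCX x s fun x' hx' => hT _ _ (by rw [hs x hx, hs x' hx', dist_self])).trans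
        (le_max_left _ _)
  have hCg : ∀ (s : Finset Y) (x : X), (∀ y ∈ s, g y = x) → s.card ≤ max C₁ C₂ :=
    fun s x hs => (hCY (f x) s fun y hy => by
      rw [← hs y hy, dist_comm]; exact hg y).trans (le_max_right _ _)
  refine IsAsymptoticExpanderSeq.of_eventually hYcdu.2.1 fun α hα => ?_
  have hα' : 0 < min α (1 / 4) := lt_min hα (by norm_num)
  obtain ⟨c, hc, R, hR⟩ := hexp.two_sided
    (α := min α (1 / 4) / (max C₁ C₂ : ℕ) ^ 2) (by positivity)
  set c' : ℝ := min (1 / 4) (c / (max C₁ C₂ : ℕ) ^ 2) with hc'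
  have hc'0 : 0 < c' := lt_min (by norm_num) (by positivity)
  refine ⟨c', ⟨hc'0, (min_le_left _ _).trans_lt (by norm_num)⟩,
    max (2 * δ) (ρ' R + δ), ?_⟩
  filter_upwards [hYcdu.eventually_mem δ, eventually_exists_preimage_piece hXcdu hYcdu
    hXconn hYconn hρ' hρ (fun x y => (hf x y).1) (fun x y => (hf x y).2) hg]
    with m hm hpre A hA hA1 hA2
  obtain ⟨n, hn⟩ := hpre
  have hQ : (0 : ℝ) < (Yn m).card := by exact_mod_cast (hYcdu.2.1 m).card_pos
  have key := card_outBdry_ge_of_map hC hδ hρ' (fun x y => (hf x y).2)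
    (fun x hx => (hn x).1 hx)
    (fun y hy => (hn _).2 (hm y hy _ (by rw [dist_comm]; exact hg y))) hg hCf hCg hα'
    (min_le_right _ _) hc.le (hR n) (le_max_left _ _) (le_max_right _ _) hA
    ((mul_le_mul_of_nonneg_right (min_le_left _ _) hQ.le).trans hA1) hA2
  exact (mul_lt_mul_of_pos_left (by linarith) hc'0).trans_le key
end
end
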